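/- Let e be an idempotent of A and let B := A/AeA. Let M be a finite-dimensional A-module with e·M = 0, regarded as a B-module. Suppose there exist finite-dimensional projective B-modules P_1 and P_0 and a B-module homomorphism f : P_1 → P_0 with Coker(f) ≅ M and rank(f) = r_B(P_1,P_0), where r_B(P_1,P_0) is the maximum of rank over all B-module homomorphisms P_1 → P_0. Then there exist finite-dimensional projective A-modules Q_1 and Q_0 and an A-module homomorphism g : Q_1 → Q_0 with Coker(g) ≅ M as A-modules and rank(g) = r_A(Q_1,Q_0), where r_A(Q_1,Q_0) is the maximum of rank over all A-module homomorphisms Q_1 → Q_0. -/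

import Mathlib

/-- The rank of an `A`-linear map between modules over a `K`-algebra `A`:
the `K`-dimension of its image. -/
noncomputable def rk (K : Type*) [Field K] {A : Type*} [Ring A] [Algebra K A]
    {M N : Type*} [AddCommGroup M] [Module A M]
    [AddCommGroup N] [Module A N] [Module K N] [IsScalarTower K A N]
    (f : M →ₗ[A] N) : ℕ :=
  Module.finrank K ((LinearMap.range f).restrictScalars K)

/-- `rmax K A M N` is `r(M,N)`, the maximal rank of an `A`-linear map `M → N`. -/
noncomputable def rmax (K : Type*) [Field K] (A : Type*) [Ring A] [Algebra K A]
    (M N : Type*) [AddCommGroup M] [Module A M]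
    [AddCommGroup N] [Module A N] [Module K N] [IsScalarTower K A N] : ℕ :=
  sSup {n : ℕ | ∃ f : M →ₗ[A] N, rk K f = n}

/-- The data of a presentation of an `A`-module `M` as the cokernel of a map of maximal
rank between finite-dimensional projective `A`-modules. -/
structure MaxRankPresentation (K : Type) [Field K] (A : Type) [Ring A] [Algebra K A]
    (M : Type) [AddCommGroup M] [Module A M] : Type 1 where
  Q₁ : Type
  Q₀ : Type
  [acg₁ : AddCommGroup Q₁]
  [acg₀ : AddCommGroup Q₀]
  [mod₁ : Module A Q₁]
  [mod₀ : Module A Q₀]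
  [modK₁ : Module K Q₁]
  [modK₀ : Module K Q₀]
  [tow₁ : IsScalarTower K A Q₁]
  [tow₀ : IsScalarTower K A Q₀]
  findim₁ : FiniteDimensional K Q₁
  findim₀ : FiniteDimensional K Q₀
  proj₁ : Module.Projective A Q₁
  proj₀ : Module.Projective A Q₀
  g : Q₁ →ₗ[A] Q₀
  max_rank : rk K g = rmax K A Q₁ Q₀
  coker_iso : Nonempty ((Q₀ ⧸ LinearMap.range g) ≃ₗ[A] M)

/-- The submodule `AeA • N` of an `A`-module `N`: the `A`-span of `e • N`. -/
def idemSpan {A : Type*} [Ring A] (e : A) (N : Type*) [AddCommGroup N] [Module A N] :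
    Submodule A N :=
  Submodule.span A (Set.range fun x : N => e • x)

section Rank

variable {K A : Type*} [Field K] [Ring A] [Algebra K A]
  {M N P : Type*} [AddCommGroup M] [Module A M]
  [AddCommGroup N] [Module A N] [Module K N] [IsScalarTower K A N]
  [AddCommGroup P] [Module A P] [Module K P] [IsScalarTower K A P]

theorem rk_le_rmax [FiniteDimensional K N] (f : M →ₗ[A] N) : rk K f ≤ rmax K A M N :=
  le_csSup ⟨Module.finrank K N, by rintro _ ⟨g, rfl⟩; exact Submodule.finrank_le _⟩ ⟨f, rfl⟩

theorem rmax_le {n : ℕ} (h : ∀ f : M →ₗ[A] N, rk K f ≤ n) : rmax K A M N ≤ n :=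
  csSup_le ⟨_, 0, rfl⟩ (by rintro _ ⟨g, rfl⟩; exact h g)

theorem rk_eq_rk_comp_add [FiniteDimensional K N] (h : M →ₗ[A] N) (p : N →ₗ[A] P) :
    rk K h = rk K (p ∘ₗ h) + Module.finrank K
      ((LinearMap.range h ⊓ LinearMap.ker p).restrictScalars K) := by
  let S := (LinearMap.range h).restrictScalars K
  let q := (p.restrictScalars K).domRestrict S
  have hrange : LinearMap.range q = (LinearMap.range (p ∘ₗ h)).restrictScalars K := by
    ext x; simp [q, S]
  have hker : (LinearMap.ker q).map S.subtype =
      (LinearMap.range h ⊓ LinearMap.ker p).restrictScalars K := by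
    ext x
    simp only [Submodule.mem_map, LinearMap.mem_ker, Submodule.restrictScalars_mem,
      Submodule.mem_inf]
    constructor
    · rintro ⟨y, hy, rfl⟩
      exact ⟨y.2, hy⟩
    · rintro ⟨hx, hpx⟩
      exact ⟨⟨x, hx⟩, hpx, rfl⟩
  have := q.finrank_range_add_finrank_ker
  rw [hrange, ← Submodule.finrank_map_subtype_eq, hker] at this
  exact this.symm

end Rank

section Lift

universe u

variable {A B : Type*} [Ring A] [Ring B] (π : A →+* B)

/-- An `A`-linear map between modules over a quotient ring `B` of `A` is `B`-linear. -/
def LinearMap.extendOfSurjective (hπ : Function.Surjective π)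
    {M N : Type*} [AddCommGroup M] [Module A M] [Module B M]
    [AddCommGroup N] [Module A N] [Module B N] (hM : ∀ (a : A) (m : M), π a • m = a • m)
    (hN : ∀ (a : A) (n : N), π a • n = a • n) (f : M →ₗ[A] N) : M →ₗ[B] N where
  toFun := f
  map_add' := f.map_add
  map_smul' b x := by
    obtain ⟨a, rfl⟩ := hπ b
    simp [hM, hN]

theorem LinearMap.exists_comp_eq_of_ker_le {Q P N : Type*} [AddCommGroup Q] [Module A Q]
    [AddCommGroup P] [Module A P] [AddCommGroup N] [Module A N]
    (p : Q →ₗ[A] P) (hp : Function.Surjective p) (φ : Q →ₗ[A] N)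
    (h : LinearMap.ker p ≤ LinearMap.ker φ) : ∃ ψ : P →ₗ[A] N, ψ ∘ₗ p = φ := by
  refine ⟨(LinearMap.ker p).liftQ φ h ∘ₗ (p.quotKerEquivOfSurjective hp).symm.toLinearMap, ?_⟩
  ext x
  have : (p.quotKerEquivOfSurjective hp).symm (p x) = (LinearMap.ker p).mkQ x := by
    rw [LinearEquiv.symm_apply_eq]; rfl
  simp [this]

theorem smul_mem_idemSpan {e : A} {N : Type*} [AddCommGroup N] [Module A N] {a : A}
    (ha : a ∈ Submodule.span A {y : A | ∃ b : A, y = e * b}) (x : N) :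
    a • x ∈ idemSpan e N := by
  induction ha using Submodule.span_induction with
  | mem y hy =>
    obtain ⟨b, rfl⟩ := hy
    exact Submodule.subset_span ⟨b • x, (mul_smul _ _ _).symm⟩
  | zero => simp
  | add y z _ _ hy hz => rw [add_smul]; exact add_mem hy hz
  | smul c y _ hy => rw [smul_assoc]; exact Submodule.smul_mem _ _ hy

theorem map_idemSpan_le {e : A} {N N' : Type*} [AddCommGroup N] [Module A N]
    [AddCommGroup N'] [Module A N'] (f : N →ₗ[A] N') :
    (idemSpan e N).map f ≤ idemSpan e N' := by
  rw [idemSpan, Submodule.map_span, Submodule.span_le]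
  rintro _ ⟨_, ⟨x, rfl⟩, rfl⟩
  exact Submodule.subset_span ⟨f x, (f.map_smul e x).symm⟩

theorem Module.Projective.of_isCompl {N : Type*} [AddCommGroup N] [Module A N]
    [Module.Projective A N] {S T : Submodule A N} (h : IsCompl S T) : Module.Projective A S :=
  .of_split S.subtype (S.projectionOnto T h) (Submodule.projectionOnto_comp_subtype h)

/-- A finite module over an Artinian ring admits a projective cover, in the form of a
projective module `N` onto it such that every endomorphism of `N` over it is surjective. -/
theorem exists_projective_minimal [IsArtinianRing A] (P : Type*) [AddCommGroup P] [Module A P]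
    [Module.Finite A P] :
    ∃ (n : ℕ) (N : Submodule A (Fin n → A)) (p : N →ₗ[A] P), Module.Projective A N ∧
      Function.Surjective p ∧
      ∀ φ : N →ₗ[A] N, p ∘ₗ φ = p → Function.Surjective φ := by
  obtain ⟨n, q, hq⟩ := Module.Finite.exists_fin' A P
  let C : Set (Submodule A (Fin n → A)) :=
    {N | Module.Projective A N ∧ Function.Surjective (q ∘ₗ N.subtype)}
  have hC : C.Nonempty :=
    ⟨⊤, .of_equiv' Submodule.topEquiv.symm, fun y => by
      obtain ⟨x, rfl⟩ := hq y
      exact ⟨⟨x, trivial⟩, rfl⟩⟩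
  obtain ⟨N, ⟨hN, hNq⟩, hmin⟩ := WellFounded.has_min
    (IsWellFounded.wf : WellFounded ((· < ·) : Submodule A (Fin n → A) → _ → Prop)) C hC
  refine ⟨n, N, q ∘ₗ N.subtype, hN, hNq, fun φ hφ => ?_⟩
  obtain ⟨k, hk⟩ := Filter.eventually_atTop.mp
    (LinearMap.eventually_isCompl_ker_pow_range_pow (φ : Module.End A N))
  have hcompl := hk (k + 1) (Nat.le_succ k)
  have hpow (m : ℕ) (x : N) : q ((φ ^ m : Module.End A N) x) = q x := by
    induction m with
    | zero => simp
    | succ m ih =>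
      rw [pow_succ', Module.End.mul_apply, ← ih]
      exact LinearMap.congr_fun hφ _
  let S := LinearMap.range (φ ^ (k + 1) : Module.End A N)
  have hS : Module.Projective A S := .of_isCompl hcompl.symm
  have hSC : S.map N.subtype ∈ C := by
    refine ⟨.of_equiv' (Submodule.equivMapOfInjective _ N.injective_subtype S), fun y => ?_⟩
    obtain ⟨x, rfl⟩ := hNq y
    exact ⟨⟨_, Submodule.mem_map_of_mem (LinearMap.mem_range_self _ x)⟩, hpow (k + 1) x⟩
  have hSN : S.map N.subtype = N :=
    eq_of_le_of_not_lt (Submodule.map_subtype_le N S) (hmin _ hSC)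
  have hStop : S = ⊤ := by
    apply Submodule.map_injective_of_injective N.injective_subtype
    rw [hSN, Submodule.map_subtype_top]
  intro y
  obtain ⟨x, hx⟩ : y ∈ S := hStop ▸ trivial
  rw [pow_succ', Module.End.mul_apply] at hx
  exact ⟨_, hx⟩

/-- Finite projective modules lift along the quotient map `A → A / AeA`, when `A` is Artinian. -/
theorem exists_projective_lift [IsArtinianRing A] (hπ : Function.Surjective π) {e : A}
    (hker : ∀ x : A, π x = 0 ↔ x ∈ Submodule.span A {y : A | ∃ b : A, y = e * b})
    (P : Type*) [AddCommGroup P] [Module A P] [Module B P]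
    (hP : ∀ (a : A) (x : P), π a • x = a • x) [Module.Finite A P] [Module.Projective B P] :
    ∃ (n : ℕ) (N : Submodule A (Fin n → A)) (p : N →ₗ[A] P), Module.Projective A N ∧
      Function.Surjective p ∧ LinearMap.ker p = idemSpan e N := by
  obtain ⟨n, N, p, hN, hp, hmin⟩ := exists_projective_minimal (A := A) P
  refine ⟨n, N, p, hN, hp, ?_⟩
  let J := idemSpan e N
  have he : π e = 0 := (hker e).2 (Submodule.subset_span ⟨1, (mul_one e).symm⟩)
  have hJ : J ≤ LinearMap.ker p := by
    refine Submodule.span_le.2 ?_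
    rintro _ ⟨x, rfl⟩
    simp [← hP, he]
  have hann {a : A} (ha : π a = 0) (x : N ⧸ J) : a • x = 0 := by
    obtain ⟨x, rfl⟩ := J.mkQ_surjective x
    rw [← map_smul]
    exact (Submodule.Quotient.mk_eq_zero J).2 (smul_mem_idemSpan ((hker a).1 ha) x)
  let : SMul B (N ⧸ J) := ⟨fun b x => Function.surjInv hπ b • x⟩
  have hsmul (a : A) (x : N ⧸ J) : π a • x = a • x := by
    rw [← sub_eq_zero]
    refine (sub_smul _ a x).symm.trans (hann ?_ x)
    rw [map_sub, Function.surjInv_eq hπ, sub_self]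
  let : Module B (N ⧸ J) := Function.Surjective.moduleLeft π hπ hsmul
  let pbar : N ⧸ J →ₗ[A] P := J.liftQ p hJ
  have hpbar : Function.Surjective pbar := fun y => by
    obtain ⟨x, rfl⟩ := hp y
    exact ⟨J.mkQ x, rfl⟩
  obtain ⟨s, hs⟩ := Module.projective_lifting_property
    (LinearMap.extendOfSurjective π hπ hsmul hP pbar) (LinearMap.id : P →ₗ[B] P) hpbar
  have hs (x : P) : pbar (s x) = x := LinearMap.congr_fun hs x
  let sA : P →ₗ[A] N ⧸ J :=
    { toFun := s
      map_add' := s.map_add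
      map_smul' := fun a x => by simp [← hP, ← hsmul] }
  obtain ⟨φ, hφ⟩ := Module.projective_lifting_property J.mkQ (sA ∘ₗ p) J.mkQ_surjective
  have hφ (x : N) : J.mkQ (φ x) = s (p x) := LinearMap.congr_fun hφ x
  have hφsurj := hmin φ (LinearMap.ext fun x => by
    change pbar (J.mkQ (φ x)) = p x
    rw [hφ, hs])
  refine le_antisymm (fun y hy => ?_) hJ
  obtain ⟨x, rfl⟩ := hφsurj y
  have hpx : p x = 0 := by
    rw [← hs (p x), ← hφ]
    exact hy
  refine (Submodule.Quotient.mk_eq_zero J).1 ((hφ x).trans ?_)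
  rw [hpx, map_zero]

/-- For an idempotent `e` there is a finite projective module `R = AeR` mapping onto `AeN`. -/
theorem exists_projective_range_eq_idemSpan {N : Type u} [IsNoetherianRing A]
    {e : A} (he : IsIdempotentElem e) [AddCommGroup N] [Module A N] [Module.Finite A N] :
    ∃ (ι : Type u) (_ : Finite ι) (R : Submodule A (ι → A)) (r : R →ₗ[A] N),
      Module.Projective A R ∧ idemSpan e R = ⊤ ∧ LinearMap.range r = idemSpan e N := by
  classical
  obtain ⟨s, hs, hspan⟩ := Submodule.fg_span_iff_fg_span_finset_subset (R := A)
    (Set.range fun x : N => e • x) |>.1 (IsNoetherian.noetherian _)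
  let ρ : (s → A) →ₗ[A] (s → A) := (LinearMap.toSpanSingleton A A e).compLeft s
  have hρ (c : s → A) (i : s) : ρ c i = c i * e := rfl
  let R := LinearMap.range ρ
  let r : R →ₗ[A] N := Fintype.linearCombination A (fun i : s => (i : N)) ∘ₗ R.subtype
  have hproj : Module.Projective A R := by
    refine .of_split R.subtype ρ.rangeRestrict ?_
    ext ⟨_, c, rfl⟩ i
    simp [hρ, mul_assoc, he.eq]
  have htop : idemSpan e R = ⊤ := by
    rw [eq_top_iff, ← LinearMap.range_eq_top.2 ρ.surjective_rangeRestrict,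
      LinearMap.range_eq_map, ← (Pi.basisFun A s).span_eq, Submodule.map_span, Submodule.span_le]
    rintro _ ⟨_, ⟨i, rfl⟩, rfl⟩
    refine Submodule.subset_span ⟨ρ.rangeRestrict (Pi.basisFun A s i), ?_⟩
    ext j
    by_cases h : j = i
    · subst h; simp [hρ, he.eq]
    · simp [hρ, h]
  refine ⟨s, inferInstance, R, r, hproj, htop, le_antisymm ?_ ?_⟩
  · rw [LinearMap.range_eq_map, ← htop]
    exact map_idemSpan_le r
  · rw [idemSpan, hspan, Submodule.span_le]
    intro y hy
    obtain ⟨x, rfl⟩ := hs hy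
    refine ⟨ρ.rangeRestrict (Pi.single ⟨_, hy⟩ 1), ?_⟩
    simp [r, Fintype.linearCombination_apply, hρ, Pi.single_apply, ite_smul, smul_smul, he.eq]

end Lift

theorem stmt9 (K A : Type) [Field K] [IsAlgClosed K] [Ring A] [Algebra K A]
    [FiniteDimensional K A]
    (e : A) (he : IsIdempotentElem e)
    -- `B` is the quotient algebra `A / AeA`, presented via a surjective algebra
    -- homomorphism `π : A → B` whose kernel is the two-sided ideal `AeA`,
    -- i.e. the left `A`-span of the set `e·A`.
    (B : Type) [Ring B] [Algebra K B]
    (π : A →ₐ[K] B) (hπsurj : Function.Surjective π)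
    (hπker : ∀ x : A, π x = 0 ↔ x ∈ Submodule.span A {y : A | ∃ b : A, y = e * b})
    -- `M` is a finite-dimensional `A`-module with `e • M = 0`, regarded as a `B`-module.
    (M : Type) [AddCommGroup M] [Module A M] [Module K M] [IsScalarTower K A M]
    [FiniteDimensional K M]
    (heM : ∀ m : M, e • m = 0)
    [Module B M] (hBM : ∀ (a : A) (m : M), π a • m = a • m)
    -- a presentation of `M` over `B` of maximal rank
    (P₁ P₀ : Type)
    [AddCommGroup P₁] [Module B P₁] [Module K P₁] [IsScalarTower K B P₁] [FiniteDimensional K P₁]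
    [AddCommGroup P₀] [Module B P₀] [Module K P₀] [IsScalarTower K B P₀] [FiniteDimensional K P₀]
    (hproj₁ : Module.Projective B P₁) (hproj₀ : Module.Projective B P₀)
    (f : P₁ →ₗ[B] P₀)
    (hfmax : rk K f = rmax K B P₁ P₀)
    (hfcoker : Nonempty ((P₀ ⧸ LinearMap.range f) ≃ₗ[B] M)) :
    Nonempty (MaxRankPresentation K A M) := by
  have hart : IsArtinianRing A := .of_finite K A
  have hnoeth : IsNoetherianRing A := .of_finite K A
  let _ : Module A P₁ := Module.compHom P₁ π.toRingHom
  let _ : Module A P₀ := Module.compHom P₀ π.toRingHom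
  have hP₁ (a : A) (x : P₁) : π.toRingHom a • x = a • x := rfl
  have hP₀ (a : A) (x : P₀) : π.toRingHom a • x = a • x := rfl
  have : IsScalarTower K A P₁ := ⟨fun k a x => by
    rw [← hP₁, ← hP₁, ← smul_assoc]; exact congrArg (· • x) (map_smul π k a)⟩
  have : IsScalarTower K A P₀ := ⟨fun k a x => by
    rw [← hP₀, ← hP₀, ← smul_assoc]; exact congrArg (· • x) (map_smul π k a)⟩
  have : Module.Finite A P₁ := .of_restrictScalars_finite K A P₁
  have : Module.Finite A P₀ := .of_restrictScalars_finite K A P₀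
  obtain ⟨n₁, Q₁, p₁, hQ₁, hp₁, hker₁⟩ := exists_projective_lift π.toRingHom hπsurj hπker P₁ hP₁
  obtain ⟨n₀, Q₀, p₀, hQ₀, hp₀, hker₀⟩ := exists_projective_lift π.toRingHom hπsurj hπker P₀ hP₀
  obtain ⟨ι, _, R, r, hR, hRtop, hr⟩ := exists_projective_range_eq_idemSpan (N := Q₀) he
  have : FiniteDimensional K Q₁ := Module.Finite.trans A Q₁
  have : FiniteDimensional K Q₀ := Module.Finite.trans A Q₀
  have : FiniteDimensional K R := Module.Finite.trans A R
  let fA : P₁ →ₗ[A] P₀ :=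
    { toFun := f
      map_add' := f.map_add
      map_smul' := fun a x => f.map_smul (π a) x }
  obtain ⟨φ, hφ⟩ := Module.projective_lifting_property p₀ (fA ∘ₗ p₁) hp₀
  let g : Q₁ × R →ₗ[A] Q₀ := φ.coprod r
  -- a map `Q₁ × R → Q₀` induces a `B`-linear map `P₁ → P₀` with the same image modulo `AeA`
  have hrange (h : Q₁ × R →ₗ[A] Q₀) (ψ : P₁ →ₗ[B] P₀)
      (hψ : ∀ x, ψ (p₁ x) = p₀ (h (x, 0))) (y : P₀) :
      y ∈ LinearMap.range (p₀ ∘ₗ h) ↔ y ∈ LinearMap.range ψ := by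
    have hzero (z : R) : p₀ (h (0, z)) = 0 := by
      have hz : h (0, z) ∈ idemSpan e Q₀ :=
        map_idemSpan_le (h ∘ₗ LinearMap.inr A Q₁ R)
          (Submodule.mem_map_of_mem (hRtop ▸ Submodule.mem_top : z ∈ idemSpan e R))
      rwa [← hker₀] at hz
    constructor
    · rintro ⟨⟨x, z⟩, rfl⟩
      refine ⟨p₁ x, ?_⟩
      rw [hψ, LinearMap.comp_apply, ← Prod.fst_add_snd (x, z), map_add, map_add, hzero, add_zero]
    · rintro ⟨x, rfl⟩
      obtain ⟨x, rfl⟩ := hp₁ x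
      exact ⟨(x, 0), (hψ x).symm⟩
  have hrk (h : Q₁ × R →ₗ[A] Q₀) (ψ : P₁ →ₗ[B] P₀)
      (hψ : ∀ x, ψ (p₁ x) = p₀ (h (x, 0))) : rk K (p₀ ∘ₗ h) = rk K ψ := by
    have : (LinearMap.range (p₀ ∘ₗ h)).restrictScalars K =
        (LinearMap.range ψ).restrictScalars K := Submodule.ext (hrange h ψ hψ)
    rw [rk, rk, this]
  have hgf (x : Q₁) : f (p₁ x) = p₀ (g (x, 0)) := by
    simpa [g, fA] using (LinearMap.congr_fun hφ x).symm
  have hgker : LinearMap.ker p₀ ≤ LinearMap.range g := by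
    rw [hker₀, ← hr]
    rintro _ ⟨z, rfl⟩
    exact ⟨(0, z), by simp [g]⟩
  obtain ⟨i⟩ := hfcoker
  let q : P₀ →ₗ[A] M :=
    { toFun := fun x => i (Submodule.Quotient.mk x)
      map_add' := fun x y => by simp
      map_smul' := fun a x => by
        rw [← hP₀, Submodule.Quotient.mk_smul, map_smul]
        exact hBM a _ }
  have hqsurj : Function.Surjective (q ∘ₗ p₀) :=
    (i.surjective.comp (Submodule.Quotient.mk_surjective _)).comp hp₀
  have hqker : LinearMap.ker (q ∘ₗ p₀) = LinearMap.range g := by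
    ext y
    have : q (p₀ y) = 0 ↔ p₀ y ∈ LinearMap.range f := by
      rw [← Submodule.Quotient.mk_eq_zero]
      exact i.map_eq_zero_iff
    rw [LinearMap.mem_ker, LinearMap.comp_apply, this, ← hrange g f hgf]
    constructor
    · rintro ⟨x, hx⟩
      have : y - g x ∈ LinearMap.range g := hgker (by simp [← hx])
      simpa using add_mem this (LinearMap.mem_range_self g x)
    · rintro ⟨x, rfl⟩
      exact ⟨x, rfl⟩
  refine ⟨{ Q₁ := Q₁ × R, Q₀ := Q₀, findim₁ := inferInstance, findim₀ := inferInstance,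
            proj₁ := inferInstance, proj₀ := hQ₀, g := g, max_rank := ?_,
            coker_iso := ⟨(Submodule.quotEquivOfEq _ _ hqker.symm).trans
              ((q ∘ₗ p₀).quotKerEquivOfSurjective hqsurj)⟩ }⟩
  refine le_antisymm (rk_le_rmax g) (rmax_le fun h => ?_)
  obtain ⟨ψ, hψ⟩ := p₁.exists_comp_eq_of_ker_le hp₁ (p₀ ∘ₗ h ∘ₗ LinearMap.inl A Q₁ R) (by
    rw [hker₁, LinearMap.ker_comp, ← Submodule.map_le_iff_le_comap, hker₀]
    exact map_idemSpan_le _)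
  let ψB := LinearMap.extendOfSurjective π.toRingHom hπsurj hP₁ hP₀ ψ
  rw [rk_eq_rk_comp_add h p₀, rk_eq_rk_comp_add g p₀, hrk g f hgf,
    hrk h ψB (LinearMap.congr_fun hψ), hfmax, inf_eq_right.2 hgker]
  exact add_le_add (rk_le_rmax ψB) (Submodule.finrank_mono fun _ hx => hx.2)
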